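/- Let r₁, r₂, m be integers with 0 < r₁ < r₂ < m and r₁ odd. Then there exist two sets C, D ⊆ ℕ with C ∪ D = ℕ and C ∩ D = (r₁ + mℕ) ∪ (r₂ + mℕ) such that R_C(n) = R_D(n) for all n ∈ ℕ if and only if there exists a positive integer l such that r₁ = 2^(2l) − 1, r₂ = 2^(2l+1) + 2^(2l) − 2, and m = 2^(2l+2) − 2. -/

import Mathlib

/-- `R S n` is the number of pairs `(s, s')` with `s, s' ∈ S`, `s < s'` and `s + s' = n`. -/
noncomputable def R (S : Set ℕ) (n : ℕ) : ℕ :=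
  Set.ncard {p : ℕ × ℕ | p.1 ∈ S ∧ p.2 ∈ S ∧ p.1 < p.2 ∧ p.1 + p.2 = n}

/-- `AP r m` is the arithmetic progression `r + mℕ = {r + m*k : k ∈ ℕ}`. -/
def AP (r m : ℕ) : Set ℕ := {n | ∃ k : ℕ, n = r + m * k}

/-- The Thue–Morse sequence with values `±1`. -/
def thueMorse (n : ℕ) : ℤ := (-1) ^ (Nat.digits 2 n).sum

namespace thueMorse

theorem zero : thueMorse 0 = 1 := by simp [thueMorse]

theorem two_mul (n : ℕ) : thueMorse (2 * n) = thueMorse n := by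
  rcases Nat.eq_zero_or_pos n with rfl | hn
  · rfl
  · simp [thueMorse, Nat.digits_base_mul (by norm_num : 1 < 2) hn]

theorem two_mul_add_one (n : ℕ) : thueMorse (2 * n + 1) = -thueMorse n := by
  have h := Nat.digits_add 2 (by norm_num) 1 n (by norm_num) (Or.inl one_ne_zero)
  rw [thueMorse, add_comm (2 * n), h, List.sum_cons, pow_add, thueMorse]
  ring

theorem eq_one_or (n : ℕ) : thueMorse n = 1 ∨ thueMorse n = -1 :=
  neg_one_pow_eq_or ℤ _

theorem one : thueMorse 1 = -1 := by simpa [zero] using two_mul_add_one 0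

theorem two : thueMorse 2 = -1 := by simpa [one] using two_mul 1

theorem two_pow_add (k : ℕ) : ∀ n < 2 ^ k, thueMorse (2 ^ k + n) = -thueMorse n := by
  induction k with
  | zero =>
    intro n hn
    obtain rfl : n = 0 := by simpa using hn
    simp [zero, one]
  | succ k ih =>
    intro n hn
    rw [pow_succ] at hn ⊢
    rcases Nat.even_or_odd' n with ⟨y, rfl | rfl⟩
    · rw [show 2 ^ k * 2 + 2 * y = 2 * (2 ^ k + y) by ring, two_mul, two_mul, ih y (by omega)]
    · rw [show 2 ^ k * 2 + (2 * y + 1) = 2 * (2 ^ k + y) + 1 by ring, two_mul_add_one,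
        two_mul_add_one, ih y (by omega)]

theorem two_pow_sub_one_sub (k : ℕ) :
    ∀ n < 2 ^ k, thueMorse (2 ^ k - 1 - n) = (-1) ^ k * thueMorse n := by
  induction k with
  | zero =>
    intro n hn
    obtain rfl : n = 0 := by simpa using hn
    simp
  | succ k ih =>
    intro n hn
    rw [pow_succ] at hn ⊢
    rcases Nat.even_or_odd' n with ⟨y, rfl | rfl⟩
    · rw [show 2 ^ k * 2 - 1 - 2 * y = 2 * (2 ^ k - 1 - y) + 1 by omega, two_mul_add_one,
        two_mul, ih y (by omega)]
      ring
    · rw [show 2 ^ k * 2 - 1 - (2 * y + 1) = 2 * (2 ^ k - 1 - y) by omega, two_mul,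
        two_mul_add_one, ih y (by omega)]
      ring

theorem two_pow_sub_one (k : ℕ) : thueMorse (2 ^ k - 1) = (-1) ^ k := by
  simpa [zero] using two_pow_sub_one_sub k 0 (by positivity)

theorem exists_eq_two_pow (s : ℕ) (hs : 0 < s)
    (h : ∀ i < s, thueMorse (s + i) = -thueMorse i) : ∃ c, s = 2 ^ c := by
  induction s using Nat.strong_induction_on with
  | _ s ih =>
    rcases Nat.even_or_odd' s with ⟨y, rfl | rfl⟩
    · obtain ⟨c, rfl⟩ := ih y (by omega) (by omega) fun i hi => by
        rw [← two_mul, ← two_mul i, mul_add, h _ (by omega)]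
      exact ⟨c + 1, by ring⟩
    · rcases Nat.eq_zero_or_pos y with rfl | hy
      · exact ⟨0, rfl⟩
      · have h₁ := h 1 (by omega)
        have h₂ := h 2 (by omega)
        rw [show 2 * y + 1 + 1 = 2 * (y + 1) by ring, two_mul, one] at h₁
        rw [show 2 * y + 1 + 2 = 2 * (y + 1) + 1 by ring, two_mul_add_one, two] at h₂
        omega

end thueMorse

open Finset

section Representation

open Classical in
theorem R_eq_card (S : Set ℕ) (n : ℕ) :
    R S n = #{p ∈ antidiagonal n | p.1 ∈ S ∧ p.2 ∈ S ∧ p.1 < p.2} := by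
  rw [R, ← Set.ncard_coe_finset]
  congr 1
  ext p
  simp only [Set.mem_ofPred_eq, coe_filter, HasAntidiagonal.mem_antidiagonal]
  tauto

open Classical in
theorem sum_antidiagonal_indicator_mul (S : Set ℕ) (n : ℕ) :
    ∑ p ∈ antidiagonal n, S.indicator (1 : ℕ → ℤ) p.1 * S.indicator (1 : ℕ → ℤ) p.2 =
      2 * R S n + if Even n then S.indicator (1 : ℕ → ℤ) (n / 2) else 0 := by
  set χ : ℕ → ℤ := S.indicator 1 with hχ
  have hχ' (k : ℕ) : χ k = if k ∈ S then 1 else 0 := by simp [hχ, Set.indicator_apply]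
  have hlt : ∑ p ∈ antidiagonal n, (if p.1 < p.2 then χ p.1 * χ p.2 else 0) = R S n := by
    rw [R_eq_card, card_filter]
    push_cast
    refine sum_congr rfl fun p _ => ?_
    simp only [hχ']
    split_ifs <;> simp_all
  have hgt : ∑ p ∈ antidiagonal n, (if p.2 < p.1 then χ p.1 * χ p.2 else 0) = R S n := by
    rw [← hlt, ← Nat.sum_antidiagonal_swap]
    exact sum_congr rfl fun p _ => by simp only [Prod.fst_swap, Prod.snd_swap, mul_comm]
  have heq : ∑ p ∈ antidiagonal n, (if p.1 = p.2 then χ p.1 * χ p.2 else 0) =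
      if Even n then χ (n / 2) else 0 := by
    split_ifs with hn
    · obtain ⟨k, rfl⟩ := hn
      rw [sum_eq_single (k, k)]
      · simp only [hχ', show (k + k) / 2 = k by omega]
        split_ifs <;> simp_all
      · rintro ⟨a, b⟩ hab hne
        rw [HasAntidiagonal.mem_antidiagonal] at hab
        refine if_neg fun h => hne ?_
        simp only at hab h
        ext <;> simp only <;> omega
      · simp
    · refine sum_eq_zero fun p hp => if_neg fun h => hn ⟨p.1, ?_⟩
      rw [HasAntidiagonal.mem_antidiagonal] at hp
      omega
  rw [← heq, two_mul]
  nth_rewrite 1 [← hlt]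
  rw [← hgt, ← sum_add_distrib, ← sum_add_distrib]
  refine sum_congr rfl fun p _ => ?_
  rcases lt_trichotomy p.1 p.2 with h | h | h
  · simp [h, h.not_gt, h.ne]
  · simp [h]
  · simp [h, h.not_gt, h.ne']

theorem sum_antidiagonal_sub_mul_add (C D : Set ℕ) (n : ℕ) :
    ∑ p ∈ antidiagonal n, (C.indicator (1 : ℕ → ℤ) p.1 - D.indicator (1 : ℕ → ℤ) p.1) *
        (C.indicator (1 : ℕ → ℤ) p.2 + D.indicator (1 : ℕ → ℤ) p.2) =
      2 * (R C n - R D n) +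
        if Even n then C.indicator (1 : ℕ → ℤ) (n / 2) - D.indicator (1 : ℕ → ℤ) (n / 2) else 0 := by
  have hC := sum_antidiagonal_indicator_mul C n
  have hD := sum_antidiagonal_indicator_mul D n
  have hswap : ∑ p ∈ antidiagonal n, C.indicator (1 : ℕ → ℤ) p.1 * D.indicator (1 : ℕ → ℤ) p.2 =
      ∑ p ∈ antidiagonal n, D.indicator (1 : ℕ → ℤ) p.1 * C.indicator (1 : ℕ → ℤ) p.2 := by
    rw [← Nat.sum_antidiagonal_swap]
    exact sum_congr rfl fun p _ => mul_comm _ _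
  simp only [sub_mul, mul_add, sum_sub_distrib, sum_add_distrib, hC, hD, hswap]
  split_ifs <;> ring

end Representation

section Existence

open PowerSeries

/-- The truncated Thue–Morse product `∏_{j < k} (1 - X ^ 2 ^ j)`. -/
noncomputable def thueMorseProd (k : ℕ) : ℤ⟦X⟧ := ∏ j ∈ range k, (1 - X ^ 2 ^ j)

theorem coeff_thueMorseProd (k n : ℕ) :
    coeff n (thueMorseProd k) = if n < 2 ^ k then thueMorse n else 0 := by
  induction k generalizing n with
  | zero =>
    simp only [thueMorseProd, range_zero, prod_empty, coeff_one, pow_zero, Nat.lt_one_iff]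
    split_ifs with h <;> simp [h, thueMorse.zero]
  | succ k ih =>
    rw [thueMorseProd, prod_range_succ, ← thueMorseProd, mul_sub, mul_one, map_sub, coeff_mul_X_pow',
      ih, ih, pow_succ]
    by_cases h : n < 2 ^ k
    · simp [h, h.not_ge, show n < 2 ^ k * 2 by omega]
    · obtain ⟨v, rfl⟩ := Nat.exists_eq_add_of_le (not_lt.1 h)
      by_cases hv : v < 2 ^ k
      · simp [hv, thueMorse.two_pow_add k v hv, show 2 ^ k + v < 2 ^ k * 2 by omega]
      · simp [hv, show ¬ 2 ^ k + v < 2 ^ k * 2 by omega]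

theorem expand_one_sub_X_pow (p : ℕ) (hp : p ≠ 0) (k : ℕ) :
    expand p hp (1 - X ^ k : ℤ⟦X⟧) = 1 - X ^ (p * k) := by
  rw [map_sub, map_one, map_pow, expand_X, pow_mul]

theorem one_sub_X_mul_expand_thueMorseProd (k : ℕ) :
    (1 - X) * expand 2 two_ne_zero (thueMorseProd k) = (1 - X ^ 2 ^ k) * thueMorseProd k := by
  simp only [thueMorseProd, map_prod, expand_one_sub_X_pow, ← pow_succ']
  have := prod_range_succ' (fun j => (1 - X ^ 2 ^ j : ℤ⟦X⟧)) k
  rw [prod_range_succ, pow_zero, pow_one] at this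
  linear_combination -this

theorem one_sub_X_ne_zero : (1 - X : ℤ⟦X⟧) ≠ 0 := fun h => by
  simpa using congrArg constantCoeff h

theorem thueMorseProd_mul_geom_sum (k : ℕ) :
    thueMorseProd k * ∑ i ∈ range (2 ^ k), X ^ i = expand 2 two_ne_zero (thueMorseProd k) := by
  refine mul_left_cancel₀ one_sub_X_ne_zero ?_
  rw [one_sub_X_mul_expand_thueMorseProd, mul_left_comm, mul_neg_geom_sum, mul_comm]

theorem mk_thueMorse : (mk thueMorse) = (1 - X) * expand 2 two_ne_zero (mk thueMorse) := by
  ext n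
  rw [sub_mul, one_mul, map_sub, coeff_mk]
  rcases Nat.even_or_odd' n with ⟨y, rfl | rfl⟩
  · rw [coeff_expand_mul, coeff_mk, thueMorse.two_mul]
    rcases y with _ | y
    · simp
    · rw [show 2 * (y + 1) = (2 * y + 1) + 1 by ring, coeff_succ_X_mul,
        coeff_expand_of_not_dvd _ _ _ (by omega),
        sub_zero]
  · rw [coeff_succ_X_mul, coeff_expand_mul, coeff_mk, coeff_expand_of_not_dvd _ _ _ (by omega),
      thueMorse.two_mul_add_one, zero_sub]

/-- The difference of the indicator functions of the two sets of the construction with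
`r = 2 ^ k - 1` and modulus `2 r + 1`. -/
def extremalDiff (r n : ℕ) : ℤ :=
  thueMorse (n / (2 * r + 1)) * (if n % (2 * r + 1) < r then thueMorse (n % (2 * r + 1))
    else if n % (2 * r + 1) = r then 0 else -thueMorse (n % (2 * r + 1) - r))

theorem extremalDiff_eq_zero_iff (r n : ℕ) : extremalDiff r n = 0 ↔ n % (2 * r + 1) = r := by
  have h₁ := thueMorse.eq_one_or (n / (2 * r + 1))
  have h₂ := thueMorse.eq_one_or (n % (2 * r + 1))
  have h₃ := thueMorse.eq_one_or (n % (2 * r + 1) - r)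
  rw [extremalDiff]
  split_ifs <;> rcases h₁ with h₁ | h₁ <;> rcases h₂ with h₂ | h₂ <;>
    rcases h₃ with h₃ | h₃ <;> simp [*] <;> omega

theorem extremalDiff_cases (r n : ℕ) :
    extremalDiff r n = 0 ∨ extremalDiff r n = 1 ∨ extremalDiff r n = -1 := by
  have h₁ := thueMorse.eq_one_or (n / (2 * r + 1))
  have h₂ := thueMorse.eq_one_or (n % (2 * r + 1))
  have h₃ := thueMorse.eq_one_or (n % (2 * r + 1) - r)
  rw [extremalDiff]
  split_ifs <;> rcases h₁ with h₁ | h₁ <;> rcases h₂ with h₂ | h₂ <;>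
    rcases h₃ with h₃ | h₃ <;> simp [h₁, h₂, h₃]

theorem coeff_thueMorseProd_mul_one_sub (k r : ℕ) (hk : Even k) (hr : r = 2 ^ k - 1) (hr₀ : 0 < r)
    (n : ℕ) :
    coeff n (thueMorseProd k * (1 - X ^ r)) =
      if n < r then thueMorse n else if n = r then 0 else
        if n < 2 * r + 1 then -thueMorse (n - r) else 0 := by
  rw [mul_sub, mul_one, map_sub, coeff_mul_X_pow', coeff_thueMorseProd, coeff_thueMorseProd]
  have h : 2 ^ k = r + 1 := by omega
  rw [h]
  rcases lt_trichotomy n r with hn | rfl | hn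
  · simp [hn, hn.not_ge, show n < r + 1 by omega]
  · simp [thueMorse.zero, hr, thueMorse.two_pow_sub_one, hk.neg_one_pow]
  · simp only [show ¬ n < r by omega, show ¬ n < r + 1 by omega, show n ≠ r by omega, if_true,
      if_false, show r ≤ n by omega, zero_sub]
    split_ifs <;> first | rfl | omega

theorem mk_extremalDiff (k r : ℕ) (hk : Even k) (hr : r = 2 ^ k - 1) (hr₀ : 0 < r) :
    mk (extremalDiff r) =
      thueMorseProd k * (1 - X ^ r) * expand (2 * r + 1) (by omega) (mk thueMorse) := by
  ext n
  have hmod := Nat.mod_lt n (show 0 < 2 * r + 1 by omega)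
  have hdiv := Nat.mod_add_div n (2 * r + 1)
  rw [coeff_mk, coeff_mul, sum_eq_single (n % (2 * r + 1), (2 * r + 1) * (n / (2 * r + 1)))]
  · simp only [coeff_thueMorseProd_mul_one_sub k r hk hr hr₀, coeff_expand_mul, coeff_mk,
      extremalDiff, hmod, if_true]
    ring
  · rintro ⟨a, b⟩ hab hne
    rw [HasAntidiagonal.mem_antidiagonal] at hab
    simp only at hab
    simp only [coeff_thueMorseProd_mul_one_sub k r hk hr hr₀]
    by_cases ha : a < 2 * r + 1
    · rw [coeff_expand_of_not_dvd, mul_zero]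
      rintro ⟨c, rfl⟩
      apply hne
      have h₁ : n % (2 * r + 1) = a := by rw [← hab, Nat.add_mul_mod_self_left, Nat.mod_eq_of_lt ha]
      ext
      · exact h₁.symm
      · simp only; omega
    · simp [ha, show ¬ a < r by omega, show a ≠ r by omega]
  · intro h
    exact absurd (HasAntidiagonal.mem_antidiagonal.2 hdiv) h

theorem sum_antidiagonal_extremalDiff (k r : ℕ) (hk : Even k) (hr : r = 2 ^ k - 1) (hr₀ : 0 < r)
    (n : ℕ) :
    ∑ p ∈ antidiagonal n, extremalDiff r p.1 * (1 + if p.2 % (2 * r + 1) = r then 1 else 0) =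
      if Even n then extremalDiff r (n / 2) else 0 := by
  set S : ℤ⟦X⟧ := mk fun n => 1 + if n % (2 * r + 1) = r then 1 else 0 with hS
  have h2k : 2 ^ k = r + 1 := by omega
  have hper : (1 - X ^ (2 * r + 1)) * S = (∑ i ∈ range (2 ^ k), X ^ i) * (1 + X ^ r) := by
    ext j
    rw [sub_mul, one_mul, mul_add, mul_one, map_sub, map_add, coeff_X_pow_mul', coeff_mul_X_pow',
      hS, coeff_mk, coeff_mk, h2k]
    simp only [map_sum, coeff_X_pow, sum_ite_eq, mem_range]
    by_cases hj : 2 * r + 1 ≤ j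
    · rw [← Nat.mod_eq_sub_mod hj]
      simp [hj, show ¬ j < r + 1 by omega, show ¬ j - r < r + 1 by omega]
    · rw [Nat.mod_eq_of_lt (by omega)]
      split_ifs <;> first | rfl | omega
  have hT : expand (2 * r + 1) (by omega) (mk thueMorse) = (1 - X ^ (2 * r + 1)) *
      expand 2 two_ne_zero (expand (2 * r + 1) (by omega) (mk thueMorse)) := by
    conv_lhs => rw [mk_thueMorse]
    rw [map_mul, ← expand_mul, ← expand_mul]
    simp only [mul_comm 2 (2 * r + 1)]
    congr 1
    simp
  have key : mk (extremalDiff r) * S = expand 2 two_ne_zero (mk (extremalDiff r)) := by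
    rw [mk_extremalDiff k r hk hr hr₀, map_mul, map_mul, expand_one_sub_X_pow,
      ← thueMorseProd_mul_geom_sum]
    nth_rewrite 1 [hT]
    linear_combination (thueMorseProd k * (1 - X ^ r) *
      expand 2 two_ne_zero (expand (2 * r + 1) (by omega) (mk thueMorse))) * hper
  have := congrArg (coeff n) key
  rw [coeff_mul] at this
  simp only [hS, coeff_mk] at this
  rw [this]
  split_ifs with hn
  · obtain ⟨j, rfl⟩ := hn
    rw [← _root_.two_mul, coeff_expand_mul, coeff_mk, Nat.mul_div_cancel_left _ two_pos]
  · exact coeff_expand_of_not_dvd _ _ _ fun h => hn (even_iff_two_dvd.2 h)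

theorem exists_of_eq_two_pow (l : ℕ) (hl : 0 < l) (r₁ r₂ m : ℕ) (h₁ : r₁ = 2 ^ (2 * l) - 1)
    (h₂ : r₂ = 2 ^ (2 * l + 1) + 2 ^ (2 * l) - 2) (hm : m = 2 ^ (2 * l + 2) - 2) :
    ∃ C D : Set ℕ, C ∪ D = Set.univ ∧ C ∩ D = AP r₁ m ∪ AP r₂ m ∧ ∀ n : ℕ, R C n = R D n := by
  have hpow : 2 ^ 2 ≤ 2 ^ (2 * l) := Nat.pow_le_pow_right two_pos (by omega)
  have hr₂ : r₂ = 3 * r₁ + 1 := by rw [h₂, h₁, pow_succ]; omega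
  have hm' : m = 2 * (2 * r₁ + 1) := by rw [hm, h₁, pow_add]; omega
  have hinter (n : ℕ) : n % (2 * r₁ + 1) = r₁ ↔ n ∈ AP r₁ m ∪ AP r₂ m := by
    simp only [AP, Set.mem_union, Set.mem_ofPred_eq]
    constructor
    · intro h
      have hdiv := Nat.mod_add_div n (2 * r₁ + 1)
      rcases Nat.even_or_odd' (n / (2 * r₁ + 1)) with ⟨q, hq | hq⟩
      · left
        refine ⟨q, ?_⟩
        rw [← hdiv, h, hq, hm']; ring
      · right
        refine ⟨q, ?_⟩
        rw [← hdiv, h, hq, hm', hr₂]; ring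
    · rintro (⟨q, rfl⟩ | ⟨q, rfl⟩)
      · rw [hm', show r₁ + 2 * (2 * r₁ + 1) * q = r₁ + (2 * r₁ + 1) * (2 * q) by ring,
          Nat.add_mul_mod_self_left, Nat.mod_eq_of_lt (by omega)]
      · rw [hm', hr₂, show 3 * r₁ + 1 + 2 * (2 * r₁ + 1) * q =
          r₁ + (2 * r₁ + 1) * (2 * q + 1) by ring, Nat.add_mul_mod_self_left,
          Nat.mod_eq_of_lt (by omega)]
  set C : Set ℕ := {n | extremalDiff r₁ n ≠ -1}
  set D : Set ℕ := {n | extremalDiff r₁ n ≠ 1}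
  have hsub (n : ℕ) : C.indicator (1 : ℕ → ℤ) n - D.indicator (1 : ℕ → ℤ) n =
      extremalDiff r₁ n := by
    rcases extremalDiff_cases r₁ n with h | h | h <;> simp [C, D, h]
  have hadd (n : ℕ) : C.indicator (1 : ℕ → ℤ) n + D.indicator (1 : ℕ → ℤ) n =
      1 + if n % (2 * r₁ + 1) = r₁ then 1 else 0 := by
    simp only [← extremalDiff_eq_zero_iff]
    rcases extremalDiff_cases r₁ n with h | h | h <;> simp [C, D, h]
  refine ⟨C, D, ?_, ?_, fun n => ?_⟩
  · ext n
    rcases extremalDiff_cases r₁ n with h | h | h <;> simp [C, D, h]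
  · ext n
    rw [← hinter, ← extremalDiff_eq_zero_iff]
    rcases extremalDiff_cases r₁ n with h | h | h <;> simp [C, D, h]
  · have h := sum_antidiagonal_sub_mul_add C D n
    simp only [hsub, hadd] at h
    rw [sum_antidiagonal_extremalDiff (2 * l) r₁ (even_two_mul l) h₁ (by omega)] at h
    omega

end Existence

section Roots

open Polynomial in
theorem Polynomial.norm_eq_one_of_mem_roots {p : ℂ[X]} (h₀ : p.coeff 0 = 1)
    (hlead : 1 ≤ ‖p.leadingCoeff‖) (hp : ∀ z ∈ p.roots, 1 ≤ ‖z‖) : ∀ z ∈ p.roots, ‖z‖ = 1 := by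
  intro z hz
  have hprod := congrArg norm (IsAlgClosed.splits p).coeff_zero_eq_leadingCoeff_mul_prod_roots
  obtain ⟨s, hs⟩ := Multiset.exists_cons_of_mem hz
  have hrest : ∀ t : Multiset ℂ, (∀ w ∈ t, 1 ≤ ‖w‖) → 1 ≤ ‖t.prod‖ := by
    intro t
    induction t using Multiset.induction_on with
    | empty => simp
    | cons a t ih =>
      intro h
      rw [Multiset.prod_cons, norm_mul]
      exact one_le_mul_of_one_le_of_one_le (h a (Multiset.mem_cons_self a t))
        (ih fun w hw => h w (Multiset.mem_cons_of_mem hw))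
  have h₂ := hrest s fun w hw => hp w (hs ▸ Multiset.mem_cons_of_mem hw)
  have h₁ := hp z hz
  rw [h₀, hs, Multiset.prod_cons] at hprod
  simp only [norm_one, norm_mul, norm_pow, norm_neg, one_pow, one_mul] at hprod
  refine le_antisymm ?_ h₁
  have h₃ := one_le_mul_of_one_le_of_one_le hlead h₂
  nlinarith

theorem Complex.re_one_div_one_sub {z : ℂ} (hz : ‖z‖ = 1) (h₁ : z ≠ 1) :
    (1 / (1 - z)).re = 1 / 2 := by
  have h : Complex.normSq z = 1 := by rw [Complex.normSq_eq_norm_sq, hz, one_pow]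
  have h' : Complex.normSq (1 - z) ≠ 0 := by
    rw [Ne, Complex.normSq_eq_zero, sub_eq_zero]
    exact h₁.symm
  rw [one_div, Complex.inv_re, div_eq_div_iff h' two_ne_zero]
  rw [Complex.normSq_apply] at h ⊢
  simp only [Complex.sub_re, Complex.sub_im, Complex.one_re, Complex.one_im]
  linarith

open Polynomial in
theorem Polynomial.two_mul_re_eval_derivative_div {p : ℂ[X]} (h₁ : p.eval 1 ≠ 0)
    (hp : ∀ z ∈ p.roots, ‖z‖ = 1) : 2 * (p.derivative.eval 1 / p.eval 1).re = p.natDegree := by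
  rw [(IsAlgClosed.splits p).eval_derivative_div_eval_of_ne_zero h₁,
    (IsAlgClosed.splits p).natDegree_eq_card_roots, ← Complex.coe_reAddGroupHom, map_multiset_sum,
    Multiset.map_map, Multiset.map_congr rfl (g := fun _ => (1 / 2 : ℝ))]
  · simp; ring
  · intro z hz
    refine Complex.re_one_div_one_sub (hp z hz) ?_
    rintro rfl
    exact h₁ (isRoot_of_mem_roots hz)

open Polynomial in
theorem add_add_one_eq_of_forall_ne_zero {r₁ r₂ m : ℕ} (h₁ : 0 < r₁) (h₂ : r₁ < r₂) (h₃ : r₂ < m)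
    (h : ∀ z : ℂ, ‖z‖ < 1 → ∑ i ∈ range m, z ^ i + z ^ r₁ + z ^ r₂ ≠ 0) : r₁ + r₂ + 1 = m := by
  set p : ℂ[X] := ∑ i ∈ range m, X ^ i + X ^ r₁ + X ^ r₂ with hp
  have hcoeff (n : ℕ) : p.coeff n =
      (if n < m then 1 else 0) + (if n = r₁ then 1 else 0) + (if n = r₂ then 1 else 0) := by
    simp [hp, coeff_X_pow]
  have hlast : p.coeff (m - 1) = 1 + if m - 1 = r₂ then 1 else 0 := by
    rw [hcoeff]
    simp [show 0 < m by omega, show m - 1 ≠ r₁ by omega]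
  have hlast' : 1 ≤ ‖p.coeff (m - 1)‖ := by
    rw [hlast]
    split_ifs <;> norm_num
  have hdeg : p.natDegree = m - 1 := by
    refine natDegree_eq_of_le_of_coeff_ne_zero ?_ ?_
    · rw [natDegree_le_iff_coeff_eq_zero]
      intro n hn
      rw [hcoeff]
      simp [show ¬ n < m by omega, show n ≠ r₁ by omega, show n ≠ r₂ by omega]
    · exact norm_pos_iff.1 (by linarith)
  have heval : p.eval 1 = m + 2 := by
    simp [hp, eval_finsetSum]; ring
  have hm : (m + 2 : ℂ) ≠ 0 := by exact_mod_cast Nat.succ_ne_zero (m + 1)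
  have hder : p.derivative.eval 1 = (((m - 1 : ℕ) * m / 2 + r₁ + r₂ : ℝ) : ℂ) := by
    have hsum : ∑ i ∈ range m, (i : ℂ) = (m - 1 : ℕ) * m / 2 := by
      rw [eq_div_iff two_ne_zero]
      have := congrArg (Nat.cast : ℕ → ℂ) (sum_range_id_mul_two m)
      rwa [Nat.cast_mul, Nat.cast_mul, Nat.cast_sum, Nat.cast_two, mul_comm (m : ℂ)] at this
    simp [hp, eval_finsetSum, derivative_X_pow, hsum]
  have key := two_mul_re_eval_derivative_div (p := p) (by rwa [heval])
    (norm_eq_one_of_mem_roots (by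
      rw [hcoeff]
      simp [show 0 < m by omega, h₁.ne, (h₁.trans h₂).ne])
      (by rwa [leadingCoeff, hdeg]) fun z hz => by
        by_contra! hlt
        refine h z hlt ?_
        simpa [hp, IsRoot, eval_finsetSum] using isRoot_of_mem_roots hz)
  rw [hdeg, heval, hder, show (m + 2 : ℂ) = ((m + 2 : ℝ) : ℂ) by push_cast; ring,
    ← Complex.ofReal_div, Complex.ofReal_re, mul_div_assoc', div_eq_iff (by positivity)] at key
  obtain ⟨n, rfl⟩ := Nat.exists_eq_add_of_le' (show 1 ≤ m by omega)
  rw [Nat.add_sub_cancel] at key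
  push_cast at key
  have : (r₁ + r₂ : ℝ) = n := by linarith
  have : r₁ + r₂ = n := by exact_mod_cast this
  omega

theorem even_of_forall_ne_zero {r₁ r₂ m : ℕ} (h₁ : Odd r₁) (h₂ : r₁ + r₂ + 1 = m)
    (h : ∀ z : ℂ, ‖z‖ < 1 → ∑ i ∈ range m, z ^ i + z ^ r₁ + z ^ r₂ ≠ 0) : Even r₂ := by
  by_contra hodd
  rw [Nat.not_even_iff_odd] at hodd
  have hm : Odd m := h₂ ▸ (h₁.add_odd hodd).add_one
  set g : ℝ → ℝ := fun x => ∑ i ∈ range m, x ^ i + x ^ r₁ + x ^ r₂ with hg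
  have hcont : ContinuousOn g (Set.Icc (-1) 0) := by fun_prop
  have hg₁ : g (-1) = -1 := by
    simp [hg, neg_one_geom_sum, h₁.neg_one_pow, hodd.neg_one_pow, Nat.not_even_iff_odd.2 hm]
  have hg₀ : g 0 = 1 := by
    simp [hg, h₁.pos.ne', hodd.pos.ne', zero_pow_eq, hm.pos]
  obtain ⟨x, ⟨hx₁, hx₀⟩, hx⟩ := intermediate_value_Icc (by norm_num) hcont
    (show (0 : ℝ) ∈ Set.Icc (g (-1)) (g 0) by rw [hg₁, hg₀]; constructor <;> norm_num)
  have hne : x ≠ -1 := by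
    rintro rfl
    rw [hg₁] at hx
    norm_num at hx
  refine h x ?_ ?_
  · rw [Complex.norm_real, Real.norm_eq_abs, abs_lt]
    exact ⟨lt_of_le_of_ne hx₁ hne.symm, by linarith⟩
  · exact_mod_cast hx

end Roots

section PowerSeriesInDisc

theorem summable_norm_mul_pow {a : ℕ → ℤ} {c : ℝ} (ha : ∀ n, |(a n : ℝ)| ≤ c) {z : ℂ}
    (hz : ‖z‖ < 1) :
    Summable fun n => ‖(a n : ℂ) * z ^ n‖ := by
  refine Summable.of_nonneg_of_le (fun _ => norm_nonneg _) (fun n => ?_)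
    ((summable_geometric_of_lt_one (norm_nonneg z) hz).mul_left c)
  rw [norm_mul, norm_pow, Complex.norm_intCast]
  exact mul_le_mul_of_nonneg_right (ha n) (by positivity)

theorem tsum_mul_tsum_eq_tsum_sq {f s : ℕ → ℤ} {c d : ℝ} (hf : ∀ n, |(f n : ℝ)| ≤ c)
    (hs : ∀ n, |(s n : ℝ)| ≤ d)
    (hconv : ∀ n, ∑ p ∈ antidiagonal n, f p.1 * s p.2 = if Even n then f (n / 2) else 0)
    {z : ℂ} (hz : ‖z‖ < 1) :
    (∑' n, (f n : ℂ) * z ^ n) * ∑' n, (s n : ℂ) * z ^ n = ∑' n, (f n : ℂ) * (z ^ 2) ^ n := by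
  rw [tsum_mul_tsum_eq_tsum_sum_antidiagonal_of_summable_norm (summable_norm_mul_pow hf hz)
    (summable_norm_mul_pow hs hz)]
  have hterm (n : ℕ) : ∑ p ∈ antidiagonal n, (f p.1 : ℂ) * z ^ p.1 * ((s p.2 : ℂ) * z ^ p.2) =
      (if Even n then (f (n / 2) : ℂ) else 0) * z ^ n := by
    have := congrArg (fun x : ℤ => (x : ℂ) * z ^ n) (hconv n)
    push_cast [sum_mul] at this
    rw [← this]
    refine sum_congr rfl fun p hp => ?_
    rw [← HasAntidiagonal.mem_antidiagonal.1 hp, pow_add]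
    ring
  simp only [hterm]
  rw [← (mul_right_injective₀ (two_ne_zero' ℕ)).tsum_eq]
  · refine tsum_congr fun n => ?_
    rw [if_pos (even_two_mul n), Nat.mul_div_cancel_left _ two_pos, pow_mul]
  · intro n hn
    by_cases h : Even n
    · obtain ⟨k, rfl⟩ := h
      exact ⟨k, two_mul k⟩
    · simp [h] at hn

theorem tsum_ne_zero_of_norm_lt_half {f : ℕ → ℤ} (hf : ∀ n, |(f n : ℝ)| ≤ 1) (h₀ : f 0 = 1) {z : ℂ}
    (hz : ‖z‖ < 1 / 2) : ∑' n, (f n : ℂ) * z ^ n ≠ 0 := by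
  intro h
  have hz₁ : ‖z‖ < 1 := by linarith
  have hsum := summable_norm_mul_pow hf hz₁
  rw [hsum.of_norm.tsum_eq_zero_add, h₀] at h
  have htail : ‖∑' n, (f (n + 1) : ℂ) * z ^ (n + 1)‖ ≤ ‖z‖ * (1 - ‖z‖)⁻¹ := by
    refine tsum_of_norm_bounded ((hasSum_geometric_of_lt_one (norm_nonneg z) hz₁).mul_left ‖z‖)
      fun n => ?_
    rw [norm_mul, norm_pow, Complex.norm_intCast, pow_succ']
    exact mul_le_of_le_one_left (by positivity) (hf _)
  have hlt : ‖z‖ * (1 - ‖z‖)⁻¹ < 1 := by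
    rw [← div_eq_mul_inv, div_lt_one] <;> linarith
  rw [eq_neg_of_add_eq_zero_right h] at htail
  norm_num at htail
  linarith

theorem tsum_periodic {s : ℕ → ℤ} {d : ℝ} (hs : ∀ n, |(s n : ℝ)| ≤ d) {m : ℕ}
    (hper : ∀ n, s (n + m) = s n) {z : ℂ} (hz : ‖z‖ < 1) :
    (1 - z ^ m) * ∑' n, (s n : ℂ) * z ^ n = ∑ n ∈ range m, (s n : ℂ) * z ^ n := by
  have h := (summable_norm_mul_pow hs hz).of_norm.sum_add_tsum_nat_add m
  simp only [hper, pow_add] at h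
  simp only [← mul_assoc] at h
  rw [tsum_mul_right] at h
  linear_combination -h

theorem sum_mul_pow_ne_zero {f s : ℕ → ℤ} {d : ℝ} (hf : ∀ n, |(f n : ℝ)| ≤ 1) (h₀ : f 0 = 1)
    (hs : ∀ n, |(s n : ℝ)| ≤ d)
    (hconv : ∀ n, ∑ p ∈ antidiagonal n, f p.1 * s p.2 = if Even n then f (n / 2) else 0)
    {m : ℕ} (hm : 0 < m) (hper : ∀ n, s (n + m) = s n) {z : ℂ} (hz : ‖z‖ < 1) :
    ∑ n ∈ range m, (s n : ℂ) * z ^ n ≠ 0 := by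
  intro h
  rw [← tsum_periodic hs hper hz, mul_eq_zero, sub_eq_zero] at h
  replace h := h.resolve_left fun h => by
    have := congrArg norm h
    rw [norm_one, norm_pow] at this
    exact (pow_lt_one₀ (norm_nonneg z) hz hm.ne').ne' this
  have hlt (k : ℕ) : ‖z ^ 2 ^ k‖ < 1 := by
    rw [norm_pow]
    exact pow_lt_one₀ (norm_nonneg z) hz (by positivity)
  have hzero (k : ℕ) : ∑' n, (f n : ℂ) * (z ^ 2 ^ (k + 1)) ^ n = 0 := by
    induction k with
    | zero => simpa [h] using (tsum_mul_tsum_eq_tsum_sq hf hs hconv hz).symm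
    | succ k ih =>
      rw [pow_succ 2 (k + 1), pow_mul, ← tsum_mul_tsum_eq_tsum_sq hf hs hconv (hlt _), ih, zero_mul]
  obtain ⟨k, hk⟩ := exists_pow_lt_of_lt_one (show (0 : ℝ) < 1 / 2 by norm_num) hz
  refine tsum_ne_zero_of_norm_lt_half hf h₀ ?_ (hzero k)
  rw [norm_pow]
  refine (pow_le_pow_of_le_one (norm_nonneg z) hz.le ?_).trans_lt hk
  exact (Nat.lt_two_pow_self.trans (Nat.pow_lt_pow_right one_lt_two k.lt_succ_self)).le

end PowerSeriesInDisc

section Recursion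

theorem thueMorse.eq_of_even {n k : ℕ} (h : n = 2 * k) : thueMorse n = thueMorse k :=
  h ▸ two_mul k

theorem thueMorse.eq_of_odd {n k : ℕ} (h : n = 2 * k + 1) : thueMorse n = -thueMorse k :=
  h ▸ two_mul_add_one k

/-- The `n`-th coefficient of `(1 - X) X ^ r f(X)`. -/
def lagDiff (f : ℕ → ℤ) (r n : ℕ) : ℤ :=
  if n < r then 0 else if n = r then f 0 else f (n - r) - f (n - r - 1)

theorem lagDiff_of_lt {f : ℕ → ℤ} {r n : ℕ} (h : n < r) : lagDiff f r n = 0 := if_pos h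

theorem lagDiff_self (f : ℕ → ℤ) (r : ℕ) : lagDiff f r r = f 0 := by simp [lagDiff]

theorem lagDiff_of_eq {f : ℕ → ℤ} {r n j : ℕ} (h : n = r + (j + 1)) :
    lagDiff f r n = f (j + 1) - f j := by
  rw [lagDiff, if_neg (by omega), if_neg (by omega), h, Nat.add_sub_cancel_left, Nat.add_sub_cancel]

/-- The properties below `m` of the difference of the indicator functions of two sets which cover
`ℕ`, whose intersection meets `[0, m)` in `{r, q}`, and which have the same representation
function. -/
structure IsTwoPointDiff (f : ℕ → ℤ) (r q m : ℕ) : Prop where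
  apply_zero : f 0 = 1
  apply_left : f r = 0
  apply_right : f q = 0
  eq_one_or : ∀ n < m, n ≠ r → n ≠ q → f n = 1 ∨ f n = -1
  even : ∀ k, 0 < k → 2 * k < m → f (2 * k) + lagDiff f r (2 * k) + lagDiff f q (2 * k) = f k
  odd : ∀ k, 2 * k + 1 < m →
    f (2 * k + 1) + lagDiff f r (2 * k + 1) + lagDiff f q (2 * k + 1) = -f k

namespace IsTwoPointDiff

variable {f : ℕ → ℤ} {r q m : ℕ}

theorem eq_thueMorse (hf : IsTwoPointDiff f r q m) (hrq : r < q) (hqm : q < m) :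
    ∀ n < r, f n = thueMorse n := by
  intro n
  induction n using Nat.strong_induction_on with
  | _ n ih =>
    intro hn
    rcases Nat.even_or_odd' n with ⟨k, rfl | rfl⟩
    · rcases Nat.eq_zero_or_pos k with rfl | hk
      · exact hf.apply_zero.trans thueMorse.zero.symm
      · have := hf.even k hk (by omega)
        rw [lagDiff_of_lt hn, lagDiff_of_lt (hn.trans hrq), ih k (by omega) (by omega)] at this
        rw [thueMorse.two_mul]
        omega
    · have := hf.odd k (by omega)
      rw [lagDiff_of_lt hn, lagDiff_of_lt (hn.trans hrq), ih k (by omega) (by omega)] at this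
      rw [thueMorse.two_mul_add_one]
      omega

theorem add_lagDiff_eq_thueMorse (hf : IsTwoPointDiff f r q m) (hrq : r < q) (hqm : q < m) {n : ℕ}
    (h₀ : 0 < n) (hn : n < 2 * r) (hm : n < m) :
    f n + lagDiff f r n + lagDiff f q n = thueMorse n := by
  rcases Nat.even_or_odd' n with ⟨k, rfl | rfl⟩
  · rw [hf.even k (by omega) hm, hf.eq_thueMorse hrq hqm k (by omega), thueMorse.two_mul]
  · rw [hf.odd k hm, hf.eq_thueMorse hrq hqm k (by omega), thueMorse.two_mul_add_one]

theorem lagDiff_eq_thueMorse (hf : IsTwoPointDiff f r q m) (hrq : r < q) (hqm : q < m) {a n j : ℕ}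
    (h : n = a + (j + 1)) (hj : j + 1 < r) :
    lagDiff f a n = thueMorse (j + 1) - thueMorse j := by
  rw [lagDiff_of_eq h, hf.eq_thueMorse hrq hqm _ hj, hf.eq_thueMorse hrq hqm j (by omega)]

theorem thueMorse_left (hf : IsTwoPointDiff f r q m) (hr : Odd r) (hrq : r < q) (hqm : q < m) :
    thueMorse r = 1 := by
  have := hf.add_lagDiff_eq_thueMorse hrq hqm hr.pos (by have := hr.pos; omega) (hrq.trans hqm)
  rw [hf.apply_left, lagDiff_self, lagDiff_of_lt hrq, hf.apply_zero] at this
  omega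

theorem three_le_left (hf : IsTwoPointDiff f r q m) (hr : Odd r) (hrq : r < q) (hqm : q < m) :
    3 ≤ r := by
  have h := hf.thueMorse_left hr hrq hqm
  obtain ⟨u, rfl⟩ := hr
  rcases Nat.eq_zero_or_pos u with rfl | hu
  · rw [mul_zero, zero_add, thueMorse.one] at h; omega
  · omega

theorem exists_left_eq (hf : IsTwoPointDiff f r q m) (hr : Odd r) (hrq : r < q) (hqm : q < m)
    (h : thueMorse ((r + 1) / 2) = -1) : ∃ w, 0 < w ∧ r = 4 * w - 1 := by
  have hT := hf.thueMorse_left hr hrq hqm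
  obtain ⟨u, rfl⟩ := hr
  rw [thueMorse.two_mul_add_one] at hT
  rcases Nat.even_or_odd' u with ⟨v, rfl | rfl⟩
  · rw [thueMorse.eq_of_even rfl] at hT
    rw [thueMorse.eq_of_odd (k := v) (by omega)] at h
    omega
  · exact ⟨v + 1, by omega, by omega⟩

theorem exists_eq_two_pow (hf : IsTwoPointDiff f r q m) (hr : Odd r) (hrq : r < q) (hqm : q < m)
    {w : ℕ} (hw : 0 < w) (hrw : r = 4 * w - 1) (h : ∀ v < w, thueMorse (w + v) = -thueMorse v) :
    ∃ l, 0 < l ∧ r + 1 = 2 ^ (2 * l) ∧ 2 * w = 2 ^ (2 * l - 1) := by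
  obtain ⟨c, rfl⟩ := thueMorse.exists_eq_two_pow w hw h
  have hT := hf.thueMorse_left hr hrq hqm
  have hrc : r = 2 ^ (c + 2) - 1 := by rw [hrw, pow_add]; omega
  rw [hrc, thueMorse.two_pow_sub_one, neg_one_pow_eq_one_iff_even (by norm_num)] at hT
  obtain ⟨l, hl⟩ := hT
  refine ⟨l, by omega, ?_, ?_⟩
  · rw [hrc, hl, ← two_mul]
    exact Nat.sub_add_cancel Nat.one_le_two_pow
  · rw [show 2 * l - 1 = c + 1 by omega, pow_succ']

theorem two_mul_left_le_right (hf : IsTwoPointDiff f r q m) (hr : Odd r) (hq : Even q)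
    (hrq : r < q) (hm : m = r + q + 1) : 2 * r ≤ q := by
  by_contra! hlt
  have hqm : q < m := by omega
  have hlag {a n j : ℕ} (h : n = a + (j + 1)) (hj : j + 1 < r) :=
    hf.lagDiff_eq_thueMorse hrq hqm h hj
  have hrec := fun n h₀ hn => hf.add_lagDiff_eq_thueMorse (n := n) hrq hqm h₀ hn (by omega)
  have hr₃ := hf.three_le_left hr hrq hqm
  obtain ⟨d, hd₀, hd⟩ : ∃ d, 0 < d ∧ q = r + 2 * d - 1 := by
    obtain ⟨a, rfl⟩ := hr
    obtain ⟨b, rfl⟩ := hq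
    exact ⟨b - a, by omega, by omega⟩
  obtain ⟨s, hs₀, hs⟩ : ∃ s, 2 ≤ s ∧ r = 2 * s - 1 := by
    obtain ⟨a, rfl⟩ := hr
    exact ⟨a + 1, by omega, by omega⟩
  have hds : d < s := by omega
  have hmid : thueMorse (d - 1) = 1 ∧ thueMorse (s + (d - 1)) = -1 := by
    have h := hrec q (by omega) hlt
    rw [hf.apply_right, lagDiff_self, hf.apply_zero,
      hlag (j := 2 * (d - 1)) (by omega) (by omega), thueMorse.two_mul, thueMorse.two_mul_add_one,
      thueMorse.eq_of_even (n := q) (k := s + (d - 1)) (by omega)] at h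
    have := thueMorse.eq_one_or (d - 1)
    have := thueMorse.eq_one_or (s + (d - 1))
    omega
  have hlow : ∀ i < d, thueMorse (s + i) = -thueMorse i := by
    intro i hi
    rcases Nat.lt_or_ge i (d - 1) with hi' | hi'
    · have h := hrec (2 * (s + i)) (by omega) (by omega)
      rw [hlag (a := r) (j := 2 * i) (by omega) (by omega), lagDiff_of_lt (by omega)] at h
      simp only [thueMorse.two_mul, thueMorse.two_mul_add_one] at h
      have := hf.eq_one_or (2 * (s + i)) (by omega) (by omega) (by omega)
      have := thueMorse.eq_one_or i
      have := thueMorse.eq_one_or (s + i)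
      omega
    · obtain rfl : i = d - 1 := by omega
      rw [hmid.1, hmid.2]
  obtain ⟨w, hw, hrw⟩ := hf.exists_left_eq hr hrq hqm (by
    rw [show (r + 1) / 2 = s + 0 by omega, hlow 0 hd₀, thueMorse.zero])
  have hsw : s = 2 * w := by omega
  have hTd : thueMorse d = 1 := by
    have h := hrec (r + 2 * d) (by omega) (by omega)
    rw [hlag (a := r) (j := 2 * d - 1) (by omega) (by omega),
      hlag (j := 0) (by omega) (by omega), zero_add, thueMorse.one, thueMorse.zero,
      thueMorse.eq_of_odd (n := r + 2 * d) (k := s + (d - 1)) (by omega), hmid.2,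
      thueMorse.eq_of_odd (n := 2 * d - 1) (k := d - 1) (by omega), hmid.1,
      thueMorse.eq_of_even (n := 2 * d - 1 + 1) (k := d) (by omega)] at h
    have := hf.eq_one_or (r + 2 * d) (by omega) (by omega) (by omega)
    have := thueMorse.eq_one_or d
    omega
  obtain ⟨e, rfl⟩ : ∃ e, d = 2 * e := by
    rcases Nat.even_or_odd' d with ⟨e, h | h⟩
    · exact ⟨e, h⟩
    · rw [thueMorse.eq_of_odd h] at hTd
      rw [thueMorse.eq_of_even (k := e) (by omega)] at hmid
      omega
  have hhigh : ∀ v < w, thueMorse (w + v) = -thueMorse v := by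
    intro v hv
    rcases Nat.lt_or_ge (2 * v) (2 * e) with hve | hve
    · have h := hlow (2 * v) hve
      rwa [thueMorse.two_mul, thueMorse.eq_of_even (k := w + v) (by omega)] at h
    · obtain ⟨a, rfl⟩ := Nat.exists_eq_add_of_le (show e ≤ v by omega)
      have h₁ := hrec (r + 2 * (2 * (e + a) + 1)) (by omega) (by omega)
      rw [hlag (a := r) (j := 2 * (2 * (e + a)) + 1) (by omega) (by omega),
        hlag (j := 2 * (2 * a + 1)) (by omega) (by omega),
        thueMorse.eq_of_even (n := 2 * (2 * (e + a)) + 1 + 1) (k := 2 * (e + a) + 1) (by omega),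
        thueMorse.eq_of_odd (n := r + 2 * (2 * (e + a) + 1)) (k := 2 * (w + (e + a)))
          (by omega)] at h₁
      simp only [thueMorse.two_mul, thueMorse.two_mul_add_one] at h₁
      have h₂ := hrec (2 * (2 * (w + (e + a)))) (by omega) (by omega)
      rw [hlag (a := r) (j := 2 * (2 * (e + a))) (by omega) (by omega),
        hlag (j := 2 * (2 * a) + 1) (by omega) (by omega),
        thueMorse.eq_of_even (n := 2 * (2 * a) + 1 + 1) (k := 2 * a + 1) (by omega)] at h₂
      simp only [thueMorse.two_mul, thueMorse.two_mul_add_one] at h₂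
      have := hf.eq_one_or (r + 2 * (2 * (e + a) + 1)) (by omega) (by omega) (by omega)
      have := hf.eq_one_or (2 * (2 * (w + (e + a)))) (by omega) (by omega) (by omega)
      have := thueMorse.eq_one_or (w + (e + a))
      have := thueMorse.eq_one_or (e + a)
      have := thueMorse.eq_one_or a
      omega
  obtain ⟨l, hl, -, hwl⟩ := hf.exists_eq_two_pow hr hrq hqm hw hrw hhigh
  have hcompl : thueMorse (s - 2 * e) = -1 := by
    have h := thueMorse.two_pow_sub_one_sub (2 * l - 1) (2 * e - 1) (by omega)
    rw [← hwl, hmid.1, Odd.neg_one_pow ⟨l - 1, by omega⟩] at h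
    rw [show s - 2 * e = 2 * w - 1 - (2 * e - 1) by omega, h, mul_one]
  have hsucc : f (r + 1) = 1 := by
    have h := hrec (r + 1) (by omega) (by omega)
    rw [hlag (a := r) (j := 0) rfl (by omega), lagDiff_of_lt (by omega), zero_add, thueMorse.one,
      thueMorse.zero, thueMorse.eq_of_even (n := r + 1) (k := s) (by omega)] at h
    have hs' := hlow 0 hd₀
    rw [add_zero, thueMorse.zero] at hs'
    omega
  have h := hf.odd r (by omega)
  rw [lagDiff_of_eq (r := r) (j := r) (by omega),
    hlag (j := 2 * (s - 2 * e)) (by omega) (by omega), thueMorse.two_mul_add_one,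
    thueMorse.two_mul, hcompl, hsucc, hf.apply_left] at h
  have := hf.eq_one_or (2 * r + 1) (by omega) (by omega) (by omega)
  omega

theorem eq_of_two_mul_left_le_right (hf : IsTwoPointDiff f r q m) (hr : Odd r) (hq : Even q)
    (hrq : r < q) (hm : m = r + q + 1) (hle : 2 * r ≤ q) :
    ∃ l, 0 < l ∧ r + 1 = 2 ^ (2 * l) ∧ q = 3 * r + 1 := by
  have hqm : q < m := by omega
  have hlag {a n j : ℕ} (h : n = a + (j + 1)) (hj : j + 1 < r) :=
    hf.lagDiff_eq_thueMorse hrq hqm h hj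
  have hrec := fun n h₀ hn => hf.add_lagDiff_eq_thueMorse (n := n) hrq hqm h₀ hn (by omega)
  have hr₃ := hf.three_le_left hr hrq hqm
  obtain ⟨s, hs₀, hs⟩ : ∃ s, 2 ≤ s ∧ r = 2 * s - 1 := by
    obtain ⟨a, rfl⟩ := hr
    exact ⟨a + 1, by omega, by omega⟩
  have hlow : ∀ i < s - 1, thueMorse (s + i) = -thueMorse i := by
    intro i hi
    have h := hrec (2 * (s + i)) (by omega) (by omega)
    rw [hlag (a := r) (j := 2 * i) (by omega) (by omega), lagDiff_of_lt (by omega)] at h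
    simp only [thueMorse.two_mul, thueMorse.two_mul_add_one] at h
    have := hf.eq_one_or (2 * (s + i)) (by omega) (by omega) (by omega)
    have := thueMorse.eq_one_or i
    have := thueMorse.eq_one_or (s + i)
    omega
  have hTs : thueMorse s = -1 := by
    have h := hlow 0 (by omega)
    rwa [add_zero, thueMorse.zero] at h
  obtain ⟨w, hw, hrw⟩ := hf.exists_left_eq hr hrq hqm (by
    rwa [show (r + 1) / 2 = s by omega])
  obtain ⟨l, hl, hrl, -⟩ := hf.exists_eq_two_pow hr hrq hqm hw hrw (fun v hv => by
    have h := hlow (2 * v) (by omega)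
    rwa [thueMorse.two_mul, thueMorse.eq_of_even (k := w + v) (by omega)] at h)
  have hcompl (i : ℕ) (hi : i ≤ r) : thueMorse (r - i) = thueMorse i := by
    have h := thueMorse.two_pow_sub_one_sub (2 * l) i (by omega)
    rwa [(even_two_mul l).neg_one_pow, one_mul, ← hrl, Nat.add_sub_cancel] at h
  have hsnd : ∀ j, 0 < j → j < r → f (r + j) = -thueMorse j := by
    intro j hj hjr
    have h := hrec (r + j) (by omega) (by omega)
    obtain ⟨i, rfl⟩ : ∃ i, j = i + 1 := ⟨j - 1, by omega⟩
    rw [hlag (a := r) rfl (by omega), lagDiff_of_lt (by omega),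
      show r + (i + 1) = 2 ^ (2 * l) + i by omega, thueMorse.two_pow_add _ _ (by omega)] at h
    rw [show r + (i + 1) = 2 ^ (2 * l) + i by omega]
    omega
  have hTpred : thueMorse (r - 1) = -1 := by rw [hcompl 1 (by omega), thueMorse.one]
  have hdouble := hf.even r (by omega) (by omega)
  rw [lagDiff_of_eq (r := r) (j := r - 1) (by omega), show r - 1 + 1 = r by omega,
    hf.eq_thueMorse hrq hqm (r - 1) (by omega), hTpred, hf.apply_left] at hdouble
  have hq₂ : 2 * r + 2 ≤ q := by
    rcases hle.eq_or_lt with h | h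
    · rw [h, hf.apply_right, lagDiff_self, hf.apply_zero] at hdouble
      omega
    · obtain ⟨b, rfl⟩ := hq
      omega
  rw [lagDiff_of_lt (by omega)] at hdouble
  have hdouble_succ : f (2 * r + 1) = -1 := by
    have h := hf.odd r (by omega)
    rw [lagDiff_of_eq (r := r) (j := r) (by omega), lagDiff_of_lt (by omega), hf.apply_left,
      hsnd 1 (by omega) (by omega), thueMorse.one] at h
    omega
  have hthd : ∀ j, 2 ≤ j → j ≤ r →
      f (2 * r + j) + lagDiff f q (2 * r + j) = -thueMorse (j - 1) := by
    intro j hj hjr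
    rcases Nat.even_or_odd' j with ⟨a, rfl | rfl⟩
    · have : 2 * a ≠ r := by
        obtain ⟨b, rfl⟩ := hr
        omega
      have h := hf.even (r + a) (by omega) (by omega)
      rw [lagDiff_of_eq (r := r) (j := r + (2 * a - 1)) (by omega),
        hsnd (2 * a - 1) (by omega) (by omega), show r + (2 * a - 1) + 1 = r + 2 * a by omega,
        hsnd (2 * a) (by omega) (by omega), hsnd a (by omega) (by omega), thueMorse.two_mul,
        mul_add] at h
      omega
    · have h := hf.odd (r + a) (by omega)
      rw [lagDiff_of_eq (r := r) (j := r + 2 * a) (by omega),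
        hsnd (2 * a) (by omega) (by omega), hsnd a (by omega) (by omega), thueMorse.two_mul,
        mul_add] at h
      rw [Nat.add_sub_cancel, thueMorse.two_mul, ← add_assoc]
      rcases hjr.eq_or_lt with h' | h'
      · rw [show r + 2 * a + 1 = 2 * r by omega] at h
        have := hcompl (2 * a) (by omega)
        rw [show r - 2 * a = 1 by omega, thueMorse.one, thueMorse.two_mul] at this
        omega
      · rw [add_assoc r, hsnd (2 * a + 1) (by omega) h', thueMorse.two_mul_add_one] at h
        omega
  refine ⟨l, hl, hrl, ?_⟩
  rcases lt_trichotomy q (3 * r + 1) with hlt | heq | hgt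
  · exfalso
    obtain ⟨j, rfl⟩ := Nat.exists_eq_add_of_le hle
    have hj : j < r := by
      obtain ⟨b, hb⟩ := hq
      omega
    have h₁ := hthd j (by omega) hj.le
    rw [hf.apply_right, lagDiff_self, hf.apply_zero] at h₁
    have h₂ := hthd (j + 1) (by omega) hj
    rw [hlag (j := 0) (by omega) (by omega), zero_add, thueMorse.one, thueMorse.zero,
      Nat.add_sub_cancel] at h₂
    have h₃ := hf.even (r + s) (by omega) (by omega)
    rw [lagDiff_of_eq (r := r) (j := 2 * r) (by omega),
      hlag (j := r - j) (by omega) (by omega), hsnd s (by omega) (by omega), hTs, hdouble_succ,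
      hcompl j hj.le, show r - j + 1 = r - (j - 1) by omega, hcompl _ (by omega)] at h₃
    have := hf.eq_one_or (2 * r + (j + 1)) (by omega) (by omega) (by omega)
    have := hf.eq_one_or (2 * (r + s)) (by omega) (by omega) (by omega)
    have := thueMorse.eq_one_or j
    omega
  · exact heq
  · exfalso
    have hq₃ : 3 * r + 3 ≤ q := by
      obtain ⟨a, rfl⟩ := hr
      obtain ⟨b, rfl⟩ := hq
      omega
    have h₂ := hthd 2 le_rfl (by omega)
    rw [lagDiff_of_lt (by omega), thueMorse.one] at h₂
    have h := hf.odd (r + s) (by omega)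
    rw [lagDiff_of_eq (r := r) (j := 2 * r + 1) (by omega), lagDiff_of_lt (by omega),
      hsnd s (by omega) (by omega), hTs, hdouble_succ, add_assoc (2 * r) 1 1, one_add_one_eq_two]
      at h
    have := hf.eq_one_or (2 * (r + s) + 1) (by omega) (by omega) (by omega)
    omega

end IsTwoPointDiff

theorem sum_antidiagonal_mul_single (f : ℕ → ℤ) (r n : ℕ) :
    ∑ p ∈ antidiagonal n, f p.1 * (if p.2 = r then 1 else 0) = if r ≤ n then f (n - r) else 0 := by
  rw [Nat.sum_antidiagonal_eq_sum_range_succ (fun a b => f a * if b = r then 1 else 0)]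
  split_ifs with h
  · rw [sum_eq_single (n - r)]
    · rw [if_pos (by omega), mul_one]
    · intro b hb hne
      rw [mem_range] at hb
      rw [if_neg (by omega), mul_zero]
    · simp
  · refine sum_eq_zero fun b hb => ?_
    rw [if_neg (by omega), mul_zero]

theorem add_lagDiff_add_lagDiff {f g s : ℕ → ℤ} {r q m : ℕ}
    (hs : ∀ n < m, s n = 1 + (if n = r then 1 else 0) + if n = q then 1 else 0)
    (hconv : ∀ n, ∑ p ∈ antidiagonal n, f p.1 * s p.2 = g n) {n : ℕ} (hn : n + 1 < m) :
    f (n + 1) + lagDiff f r (n + 1) + lagDiff f q (n + 1) = g (n + 1) - g n := by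
  have hsum (n : ℕ) (hn : n < m) : ∑ i ∈ range (n + 1), f i + (if r ≤ n then f (n - r) else 0) +
      (if q ≤ n then f (n - q) else 0) = g n := by
    rw [← hconv, ← sum_antidiagonal_mul_single, ← sum_antidiagonal_mul_single,
      ← Nat.sum_antidiagonal_eq_sum_range_succ (fun a _ => f a), ← sum_add_distrib,
      ← sum_add_distrib]
    refine sum_congr rfl fun p hp => ?_
    rw [hs p.2 (by have := HasAntidiagonal.mem_antidiagonal.1 hp; omega)]
    ring
  have hlag (a : ℕ) : (if a ≤ n + 1 then f (n + 1 - a) else 0) - (if a ≤ n then f (n - a) else 0) =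
      lagDiff f a (n + 1) := by
    rcases lt_trichotomy a (n + 1) with h | rfl | h
    · rw [if_pos h.le, if_pos (by omega), lagDiff_of_eq (j := n - a) (by omega)]
      congr 2
      omega
    · simp [lagDiff_self]
    · rw [lagDiff_of_lt h, if_neg (by omega), if_neg (by omega), sub_zero]
  rw [← hsum (n + 1) hn, ← hsum n (by omega), sum_range_succ _ (n + 1), ← hlag, ← hlag]
  ring

end Recursion

section Main

theorem mem_AP_union_iff {r₁ r₂ m : ℕ} (h₁ : r₁ < m) (h₂ : r₂ < m) (n : ℕ) :
    n ∈ AP r₁ m ∪ AP r₂ m ↔ n % m = r₁ ∨ n % m = r₂ := by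
  have h {r : ℕ} (hr : r < m) : n ∈ AP r m ↔ n % m = r := by
    constructor
    · rintro ⟨k, rfl⟩
      rw [Nat.add_mul_mod_self_left, Nat.mod_eq_of_lt hr]
    · rintro rfl
      exact ⟨n / m, (Nat.mod_add_div n m).symm⟩
  rw [Set.mem_union, h h₁, h h₂]

theorem exists_eq_two_pow_of_zero_mem {r₁ r₂ m : ℕ} (h₁ : 0 < r₁) (h₂ : r₁ < r₂) (h₃ : r₂ < m)
    (h₄ : Odd r₁) {C D : Set ℕ} (hunion : C ∪ D = Set.univ)
    (hinter : C ∩ D = AP r₁ m ∪ AP r₂ m) (hR : ∀ n, R C n = R D n) (h₀ : 0 ∈ C) :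
    ∃ l : ℕ, 0 < l ∧ r₁ = 2 ^ (2 * l) - 1 ∧
      r₂ = 2 ^ (2 * l + 1) + 2 ^ (2 * l) - 2 ∧ m = 2 ^ (2 * l + 2) - 2 := by
  classical
  have hmem (n : ℕ) : n ∈ C ∧ n ∈ D ↔ n % m = r₁ ∨ n % m = r₂ := by
    rw [← mem_AP_union_iff (h₂.trans h₃) h₃, ← hinter, Set.mem_inter_iff]
  have hcover (n : ℕ) : n ∈ C ∨ n ∈ D := by
    rw [← Set.mem_union, hunion]
    trivial
  set f : ℕ → ℤ := fun n => C.indicator 1 n - D.indicator 1 n with hf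
  set s : ℕ → ℤ := fun n => C.indicator 1 n + D.indicator 1 n with hs
  have hconv (n : ℕ) :
      ∑ p ∈ antidiagonal n, f p.1 * s p.2 = if Even n then f (n / 2) else 0 := by
    rw [sum_antidiagonal_sub_mul_add, hR, sub_self, mul_zero, zero_add]
  have hf_mem {n : ℕ} (h : n % m = r₁ ∨ n % m = r₂) : f n = 0 := by
    have := (hmem n).2 h
    simp [hf, this.1, this.2]
  have hf_not_mem {n : ℕ} (h : ¬(n % m = r₁ ∨ n % m = r₂)) : f n = 1 ∨ f n = -1 := by
    rw [← hmem] at h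
    by_cases hC : n ∈ C
    · simp [hf, hC, show n ∉ D from fun hD => h ⟨hC, hD⟩]
    · simp [hf, hC, (hcover n).resolve_left hC]
  have hf_zero : f 0 = 1 := by
    have h : ¬(0 ∈ C ∧ 0 ∈ D) := by
      rw [hmem, Nat.zero_mod]
      omega
    simp [hf, h₀, show 0 ∉ D from fun hD => h ⟨h₀, hD⟩]
  have hs_eq (n : ℕ) : s n = if n % m = r₁ ∨ n % m = r₂ then 2 else 1 := by
    rw [← if_congr (hmem n) rfl rfl]
    have := hcover n
    by_cases hC : n ∈ C <;> by_cases hD : n ∈ D <;> simp_all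
  have hs_lt (n : ℕ) (hn : n < m) :
      s n = 1 + (if n = r₁ then 1 else 0) + if n = r₂ then 1 else 0 := by
    rw [hs_eq, Nat.mod_eq_of_lt hn]
    grind
  have hroots (z : ℂ) (hz : ‖z‖ < 1) : ∑ i ∈ range m, z ^ i + z ^ r₁ + z ^ r₂ ≠ 0 := by
    have hne := sum_mul_pow_ne_zero (f := f) (s := s) (d := 2) (m := m) (z := z) (fun n => by
        by_cases h : n % m = r₁ ∨ n % m = r₂
        · simp [hf_mem h]
        · rcases hf_not_mem h with h | h <;> simp [h])
      hf_zero (fun n => by rw [hs_eq]; split_ifs <;> norm_num) hconv (by omega)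
      (fun n => by rw [hs_eq, hs_eq, Nat.add_mod_right]) hz
    convert hne using 1
    have hsplit : ∀ n ∈ range m, (s n : ℂ) * z ^ n =
        z ^ n + (if n = r₁ then z ^ n else 0) + if n = r₂ then z ^ n else 0 := by
      intro n hn
      rw [hs_lt n (mem_range.1 hn)]
      push_cast
      simp only [add_mul, one_mul, ite_mul, zero_mul]
    rw [sum_congr rfl hsplit, sum_add_distrib, sum_add_distrib, sum_ite_eq', sum_ite_eq',
      if_pos (mem_range.2 (h₂.trans h₃)), if_pos (mem_range.2 h₃)]
  have hm := add_add_one_eq_of_forall_ne_zero h₁ h₂ h₃ hroots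
  have hq := even_of_forall_ne_zero h₄ hm hroots
  have hdiff : IsTwoPointDiff f r₁ r₂ m := by
    refine ⟨hf_zero, hf_mem (.inl (Nat.mod_eq_of_lt (h₂.trans h₃))),
      hf_mem (.inr (Nat.mod_eq_of_lt h₃)), fun n hn hn₁ hn₂ => hf_not_mem ?_, ?_, ?_⟩
    · rw [Nat.mod_eq_of_lt hn]
      exact not_or.2 ⟨hn₁, hn₂⟩
    · intro k hk hkm
      have h := add_lagDiff_add_lagDiff hs_lt hconv (n := 2 * k - 1) (by omega)
      rwa [show 2 * k - 1 + 1 = 2 * k by omega, if_pos (even_two_mul k),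
        if_neg (Nat.not_even_iff_odd.2 ⟨k - 1, by omega⟩), sub_zero,
        Nat.mul_div_cancel_left k two_pos] at h
    · intro k hkm
      have h := add_lagDiff_add_lagDiff hs_lt hconv (n := 2 * k) hkm
      rwa [if_pos (even_two_mul k), if_neg (Nat.not_even_iff_odd.2 ⟨k, rfl⟩), zero_sub,
        Nat.mul_div_cancel_left k two_pos] at h
  obtain ⟨l, hl, hr, hr₂⟩ := hdiff.eq_of_two_mul_left_le_right h₄ hq h₂ hm.symm
    (hdiff.two_mul_left_le_right h₄ hq h₂ hm.symm)
  refine ⟨l, hl, by omega, ?_, ?_⟩ <;> simp only [pow_succ] <;> omega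

end Main

theorem stmt_3 (r₁ r₂ m : ℕ) (h₁ : 0 < r₁) (h₂ : r₁ < r₂) (h₃ : r₂ < m)
    (h₄ : Odd r₁) :
    (∃ C D : Set ℕ, C ∪ D = Set.univ ∧ C ∩ D = AP r₁ m ∪ AP r₂ m ∧
      ∀ n : ℕ, R C n = R D n) ↔
    ∃ l : ℕ, 0 < l ∧ r₁ = 2 ^ (2 * l) - 1 ∧
      r₂ = 2 ^ (2 * l + 1) + 2 ^ (2 * l) - 2 ∧ m = 2 ^ (2 * l + 2) - 2 := by
  constructor
  · rintro ⟨C, D, hunion, hinter, hR⟩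
    rcases (Set.mem_union _ _ _).1 (hunion ▸ Set.mem_univ 0) with h₀ | h₀
    · exact exists_eq_two_pow_of_zero_mem h₁ h₂ h₃ h₄ hunion hinter hR h₀
    · exact exists_eq_two_pow_of_zero_mem h₁ h₂ h₃ h₄ (by rwa [Set.union_comm])
        (by rwa [Set.inter_comm]) (fun n => (hR n).symm) h₀
  · rintro ⟨l, hl, hr₁, hr₂, hm⟩
    exact exists_of_eq_two_pow l hl r₁ r₂ m hr₁ hr₂ hm
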